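/- arXiv:math-ph/0601062 — 4 statements merged into one kernel-verified Lean document; each statement's English description precedes it below -/
import Mathlib

section
/- Let ψ₁, ψ₂ : ℝ → ℝ be functions each with Lipschitz constant ≤ 1, and suppose ∫_ℝ |ψ₁(x) − ψ₂(x)| dx < ∞. Then sup_{x ∈ ℝ} |ψ₁(x) − ψ₂(x)| ≤ ( 2 ∫_ℝ |ψ₁(x) − ψ₂(x)| dx )^{1/2}. -/
open MeasureTheory

theorem LipschitzWith.sq_norm_le_mul_integral_norm {E : Type*} [NormedAddCommGroup E]
    {K : NNReal} (hK : 0 < K) {f : ℝ → E} (hf : LipschitzWith K f) (hint : Integrable f)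
    (x : ℝ) : ‖f x‖ ^ 2 ≤ K * ∫ y, ‖f y‖ := by
  have hK' : (0 : ℝ) < K := hK
  set a : ℝ := ‖f x‖ / K with ha
  have ha0 : 0 ≤ a := by positivity
  have hMa : ‖f x‖ = K * a := by rw [ha]; field_simp
  have hlow (y : ℝ) : K * a - K * |y - x| ≤ ‖f y‖ := by
    have h₁ := hf.norm_sub_le y x
    have h₂ := norm_sub_norm_le (f x) (f y)
    rw [norm_sub_rev, hMa] at h₂
    rw [Real.norm_eq_abs] at h₁
    linarith
  have hi (b c : ℝ) : IntervalIntegrable (fun y => ‖f y‖) volume b c :=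
    hint.norm.intervalIntegrable
  have hleft : K * a ^ 2 / 2 ≤ ∫ y in (x - a)..x, ‖f y‖ := by
    calc K * a ^ 2 / 2 = ∫ y in (x - a)..x, (K * (a - x) + K * y) := by
          rw [intervalIntegral.integral_add (by simp)
            (Continuous.intervalIntegrable (by fun_prop) _ _), intervalIntegral.integral_const,
            intervalIntegral.integral_const_mul, integral_id, smul_eq_mul]
          ring
      _ ≤ _ := intervalIntegral.integral_mono_on (by linarith)
          (Continuous.intervalIntegrable (by fun_prop) _ _) (hi _ _) fun y hy => by
            have := hlow y
            rw [abs_of_nonpos (by linarith [hy.2])] at this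
            linarith
  have hright : K * a ^ 2 / 2 ≤ ∫ y in x..(x + a), ‖f y‖ := by
    calc K * a ^ 2 / 2 = ∫ y in x..(x + a), (K * (a + x) - K * y) := by
          rw [intervalIntegral.integral_sub (by simp)
            (Continuous.intervalIntegrable (by fun_prop) _ _), intervalIntegral.integral_const,
            intervalIntegral.integral_const_mul, integral_id, smul_eq_mul]
          ring
      _ ≤ _ := intervalIntegral.integral_mono_on (by linarith)
          (Continuous.intervalIntegrable (by fun_prop) _ _) (hi _ _) fun y hy => by
            have := hlow y
            rw [abs_of_nonneg (by linarith [hy.1])] at this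
            linarith
  have hle : ∫ y in (x - a)..(x + a), ‖f y‖ ≤ ∫ y, ‖f y‖ := by
    rw [intervalIntegral.integral_of_le (by linarith)]
    exact setIntegral_le_integral hint.norm (.of_forall fun y => norm_nonneg _)
  rw [← intervalIntegral.integral_add_adjacent_intervals (hi _ x) (hi _ _)] at hle
  calc ‖f x‖ ^ 2 = K * (K * a ^ 2) := by rw [hMa]; ring
    _ ≤ K * ∫ y, ‖f y‖ := by gcongr; linarith

/-- If ψ₁, ψ₂ : ℝ → ℝ each have Lipschitz constant ≤ 1 and
∫ |ψ₁ − ψ₂| < ∞, then sup_x |ψ₁(x) − ψ₂(x)| ≤ (2 ∫ |ψ₁ − ψ₂|)^{1/2}. -/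
theorem sup_le_sqrt_L1 (ψ₁ ψ₂ : ℝ → ℝ)
    (h₁ : LipschitzWith 1 ψ₁) (h₂ : LipschitzWith 1 ψ₂)
    (hint : Integrable (fun x => ψ₁ x - ψ₂ x)) :
    ∀ x : ℝ, |ψ₁ x - ψ₂ x| ≤ Real.sqrt (2 * ∫ x : ℝ, |ψ₁ x - ψ₂ x|) := by
  intro x
  refine Real.le_sqrt_of_sq_le ?_
  have hf : LipschitzWith 2 fun x => ψ₁ x - ψ₂ x := by
    simpa only [one_add_one_eq_two] using h₁.sub h₂
  simpa using hf.sq_norm_le_mul_integral_norm two_pos hint x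
end

section
/- Let Ψ be the set of functions ψ : ℝ → ℝ with Lipschitz constant ≤ 1 such that ∫_ℝ |ψ(x) − |x|| dx < ∞, with metric d(ψ₁, ψ₂) = ∫_ℝ |ψ₁(x) − ψ₂(x)| dx. Then d is finite on Ψ × Ψ, (Ψ, d) is a metric space, and it is complete and separable. -/
open MeasureTheory Filter

/-- The set Ψ of functions ψ : ℝ → ℝ with Lipschitz constant ≤ 1 such that
∫ |ψ(x) − |x|| dx < ∞. -/
def PsiSet : Set (ℝ → ℝ) :=
  {ψ | LipschitzWith 1 ψ ∧ Integrable (fun x : ℝ => ψ x - |x|)}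

/-- The L¹ distance d(ψ₁, ψ₂) = ∫ |ψ₁ − ψ₂|. -/
noncomputable def dL1 (f g : ℝ → ℝ) : ℝ := ∫ x : ℝ, |f x - g x|

/-- The class of `ψ - |·|` in `L¹(ℝ)`, for `ψ` in `PsiSet`. -/
noncomputable def psiToL1 (f : PsiSet) : ℝ →₁[volume] ℝ :=
  f.2.2.toL1 _

lemma psiToL1_coeFn (f : PsiSet) : psiToL1 f =ᵐ[volume] fun x => f.1 x - |x| :=
  f.2.2.coeFn_toL1

lemma integrable_sub_of_mem_PsiSet {f g : ℝ → ℝ} (hf : f ∈ PsiSet) (hg : g ∈ PsiSet) :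
    Integrable (fun x : ℝ => f x - g x) := by
  simpa [Pi.sub_def] using hf.2.sub hg.2

lemma dist_psiToL1 (f g : PsiSet) : dist (psiToL1 f) (psiToL1 g) = dL1 f g := by
  rw [dist_eq_norm, L1.norm_eq_integral_norm]
  refine integral_congr_ae ?_
  filter_upwards [Lp.coeFn_sub (psiToL1 f) (psiToL1 g), psiToL1_coeFn f, psiToL1_coeFn g]
    with x h hf hg
  rw [h, Pi.sub_apply, hf, hg, Real.norm_eq_abs, sub_sub_sub_cancel_right]

lemma psiToL1_injective : Function.Injective psiToL1 := by
  intro f g h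
  refine Subtype.ext ((f.2.1.continuous.ae_eq_iff_eq volume g.2.1.continuous).1 ?_)
  filter_upwards [psiToL1_coeFn f, psiToL1_coeFn g] with x hf hg
  rw [h, hg] at hf
  linarith

/-- An almost everywhere limit of 1-Lipschitz functions on `ℝ` agrees almost everywhere with a
1-Lipschitz function. -/
lemma exists_lipschitzWith_ae_eq_of_tendsto {F : ℕ → ℝ → ℝ} {u : ℝ → ℝ}
    (hF : ∀ n, LipschitzWith 1 (F n))
    (hu : ∀ᵐ x, Tendsto (fun n => F n x) atTop (nhds (u x))) :
    ∃ g : ℝ → ℝ, LipschitzWith 1 g ∧ u =ᵐ[volume] g := by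
  have hL : LipschitzOnWith 1 u {x | Tendsto (fun n => F n x) atTop (nhds (u x))} :=
    LipschitzOnWith.of_dist_le_mul fun x hx y hy =>
      le_of_tendsto (Tendsto.dist hx hy) (Eventually.of_forall fun n => (hF n).dist_le_mul x y)
  obtain ⟨g, hg, hgu⟩ := hL.extend_real
  exact ⟨g, hg, by filter_upwards [hu] with x hx using hgu hx⟩

lemma isClosed_range_psiToL1 : IsClosed (Set.range psiToL1) := by
  refine IsSeqClosed.isClosed fun v u hv hvu => ?_
  choose F hF using hv
  obtain ⟨s, -, hs⟩ := (tendstoInMeasure_of_tendsto_Lp hvu).exists_seq_tendsto_ae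
  have hae : ∀ᵐ x, ∀ n, v n x = (F n).1 x - |x| := by
    refine ae_all_iff.2 fun n => ?_
    rw [← hF n]
    exact psiToL1_coeFn (F n)
  obtain ⟨g, hg, hug⟩ := exists_lipschitzWith_ae_eq_of_tendsto
    (F := fun n => (F (s n)).1) (u := fun x => u x + |x|) (fun n => (F (s n)).2.1) (by
      filter_upwards [hs, hae] with x hx hv
      simpa [hv] using hx.add_const |x|)
  have hgu : u =ᵐ[volume] fun x => g x - |x| := by
    filter_upwards [hug] with x hx
    rw [← hx, add_sub_cancel_right]
  refine ⟨⟨g, hg, (L1.integrable_coeFn u).congr hgu⟩, Lp.ext ?_⟩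
  exact (psiToL1_coeFn _).trans hgu.symm

/-- The L¹ metric d is finite on Ψ × Ψ, (Ψ, d) is a metric space, and it is
complete and separable. -/
theorem Psi_complete_separable_metric :
    (∀ f ∈ PsiSet, ∀ g ∈ PsiSet, Integrable (fun x : ℝ => f x - g x)) ∧
    (∀ f ∈ PsiSet, ∀ g ∈ PsiSet, (dL1 f g = 0 ↔ f = g)) ∧
    (∀ f ∈ PsiSet, ∀ g ∈ PsiSet, dL1 f g = dL1 g f) ∧
    (∀ f ∈ PsiSet, ∀ g ∈ PsiSet, ∀ h ∈ PsiSet, dL1 f h ≤ dL1 f g + dL1 g h) ∧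
    (∀ F : ℕ → ℝ → ℝ, (∀ n, F n ∈ PsiSet) →
      (∀ ε : ℝ, 0 < ε → ∃ N, ∀ m, N ≤ m → ∀ n, N ≤ n → dL1 (F m) (F n) < ε) →
      ∃ g ∈ PsiSet, Tendsto (fun n => dL1 (F n) g) atTop (nhds 0)) ∧
    (∃ D : Set (ℝ → ℝ), D ⊆ PsiSet ∧ D.Countable ∧
      ∀ f ∈ PsiSet, ∀ ε : ℝ, 0 < ε → ∃ g ∈ D, dL1 f g < ε) := by
  refine ⟨fun f hf g hg => integrable_sub_of_mem_PsiSet hf hg, fun f hf g hg => ?_,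
    fun f hf g hg => ?_, fun f hf g hg h hh => ?_, fun F hF hC => ?_, ?_⟩
  · rw [← dist_psiToL1 ⟨f, hf⟩ ⟨g, hg⟩, dist_eq_zero, psiToL1_injective.eq_iff, Subtype.mk.injEq]
  · rw [← dist_psiToL1 ⟨f, hf⟩ ⟨g, hg⟩, ← dist_psiToL1 ⟨g, hg⟩ ⟨f, hf⟩, dist_comm]
  · rw [← dist_psiToL1 ⟨f, hf⟩ ⟨g, hg⟩, ← dist_psiToL1 ⟨g, hg⟩ ⟨h, hh⟩,
      ← dist_psiToL1 ⟨f, hf⟩ ⟨h, hh⟩]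
    exact dist_triangle _ _ _
  · have hcau : CauchySeq fun n => psiToL1 ⟨F n, hF n⟩ := by
      refine Metric.cauchySeq_iff.2 fun ε hε => ?_
      obtain ⟨N, hN⟩ := hC ε hε
      exact ⟨N, fun m hm n hn => by simpa [dist_psiToL1] using hN m hm n hn⟩
    obtain ⟨u, hu⟩ := cauchySeq_tendsto_of_complete hcau
    obtain ⟨g, rfl⟩ := isClosed_range_psiToL1.mem_of_tendsto hu
      (Eventually.of_forall fun n => Set.mem_range_self _)
    exact ⟨g, g.2, by simpa [dist_psiToL1] using tendsto_iff_dist_tendsto_zero.1 hu⟩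
  · have : Fact ((1 : ENNReal) ≠ ⊤) := ⟨ENNReal.one_ne_top⟩
    obtain ⟨t, ht, htc, hcl⟩ := (TopologicalSpace.IsSeparable.of_separableSpace
      (Set.range psiToL1)).exists_countable_dense_subset
    refine ⟨Subtype.val '' (psiToL1 ⁻¹' t), by rintro _ ⟨g, -, rfl⟩; exact g.2,
      (htc.preimage_of_injOn psiToL1_injective.injOn).image _, fun f hf ε hε => ?_⟩
    obtain ⟨v, hv, hfv⟩ := Metric.mem_closure_iff.1 (hcl ⟨⟨f, hf⟩, rfl⟩) ε hε
    obtain ⟨g, rfl⟩ := ht hv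
    exact ⟨g, ⟨g, hv, rfl⟩, by simpa [dist_psiToL1] using hfv⟩
end

section
/- Let F be a function continuous on the closed upper half-plane {z ∈ ℂ : Im z ≥ 0}, holomorphic on the open upper half-plane, and suppose there exist constants C > 0 and δ > 0 with |F(z)| ≤ C/(1 + |z|)^{1+δ} for all z with Im z ≥ 0. Then for every x ∈ ℝ, the principal value integral exists and satisfies lim_{ε → 0+} ∫_{{y ∈ ℝ : |y − x| > ε}} (Re F(y))/(x − y) dy = π · Im F(x). -/
open MeasureTheory Filter

section HalfPlane

variable {F : ℂ → ℂ} {C δ : ℝ}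

/-- A point on an upper half-circle centred on the real line has nonnegative imaginary part. -/
lemma im_ofReal_add_mul_exp_nonneg (x : ℝ) {r θ : ℝ} (hr : 0 ≤ r) (hθ : θ ∈ Set.Icc 0 Real.pi) :
    0 ≤ ((x : ℂ) + r * Complex.exp (θ * Complex.I)).im := by
  simp only [Complex.add_im, Complex.ofReal_im, Complex.im_ofReal_mul,
    Complex.exp_ofReal_mul_I_im, zero_add]
  exact mul_nonneg hr (Real.sin_nonneg_of_mem_Icc hθ)

lemma norm_le_of_decay (hC : 0 < C) (hδ : 0 < δ)
    (hdecay : ∀ z : ℂ, 0 ≤ z.im → ‖F z‖ ≤ C / (1 + ‖z‖) ^ (1 + δ)) {z : ℂ} (hz : 0 ≤ z.im) :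
    ‖F z‖ ≤ C :=
  (hdecay z hz).trans <| div_le_self hC.le <|
    Real.one_le_rpow (by linarith [norm_nonneg z]) (by linarith)

/-- Integrals over half-circles pass to the limit as the radius varies, when the integrand is
bounded. -/
lemma tendsto_halfCircle_integral {l : Filter ℝ} [l.IsCountablyGenerated] (x : ℝ) (c : ℂ)
    (hcont : ContinuousOn F {z : ℂ | 0 ≤ z.im})
    (hbound : ∀ z : ℂ, 0 ≤ z.im → ‖F z‖ ≤ C) (hl : ∀ᶠ r in l, 0 ≤ r)
    (hlim : ∀ θ ∈ Set.Icc 0 Real.pi,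
      Tendsto (fun r : ℝ => F (x + r * Complex.exp (θ * Complex.I))) l (nhds c)) :
    Tendsto (fun r : ℝ => ∫ θ in (0 : ℝ)..Real.pi, F (x + r * Complex.exp (θ * Complex.I)))
      l (nhds (Real.pi * c)) := by
  have hmem : ∀ θ ∈ Set.uIoc 0 Real.pi, θ ∈ Set.Icc 0 Real.pi := fun θ hθ => by
    rw [Set.uIoc_of_le Real.pi_pos.le] at hθ
    exact Set.Ioc_subset_Icc_self hθ
  have key := intervalIntegral.tendsto_integral_filter_of_dominated_convergence
    (μ := volume) (a := 0) (b := Real.pi) (l := l)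
    (F := fun (r : ℝ) (θ : ℝ) => F (x + r * Complex.exp (θ * Complex.I)))
    (f := fun _ => c) (fun _ => C) ?_ ?_ intervalIntegrable_const ?_
  · simpa using key
  · filter_upwards [hl] with r hr
    refine ContinuousOn.aestronglyMeasurable ?_ measurableSet_uIoc
    exact hcont.comp (by fun_prop) fun θ hθ => im_ofReal_add_mul_exp_nonneg x hr (hmem θ hθ)
  · filter_upwards [hl] with r hr
    exact .of_forall fun θ hθ => hbound _ (im_ofReal_add_mul_exp_nonneg x hr (hmem θ hθ))
  · exact .of_forall fun θ hθ => hlim θ (hmem θ hθ)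

lemma tendsto_halfCircle_integral_zero (x : ℝ)
    (hcont : ContinuousOn F {z : ℂ | 0 ≤ z.im})
    (hbound : ∀ z : ℂ, 0 ≤ z.im → ‖F z‖ ≤ C) :
    Tendsto (fun r : ℝ => ∫ θ in (0 : ℝ)..Real.pi, F (x + r * Complex.exp (θ * Complex.I)))
      (nhdsWithin 0 (Set.Ioi 0)) (nhds (Real.pi * F x)) := by
  refine tendsto_halfCircle_integral x (F x) hcont hbound ?_ fun θ hθ => ?_
  · filter_upwards [self_mem_nhdsWithin] with r hr using le_of_lt hr
  · refine (hcont (x : ℂ) (by simp)).tendsto.comp (tendsto_nhdsWithin_iff.2 ⟨?_, ?_⟩)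
    · have : Continuous fun r : ℝ => (x : ℂ) + r * Complex.exp (θ * Complex.I) := by fun_prop
      simpa using (this.tendsto 0).mono_left nhdsWithin_le_nhds
    · filter_upwards [self_mem_nhdsWithin] with r hr
      exact im_ofReal_add_mul_exp_nonneg x (le_of_lt hr) hθ

lemma tendsto_halfCircle_integral_atTop (x : ℝ)
    (hcont : ContinuousOn F {z : ℂ | 0 ≤ z.im}) (hC : 0 < C) (hδ : 0 < δ)
    (hdecay : ∀ z : ℂ, 0 ≤ z.im → ‖F z‖ ≤ C / (1 + ‖z‖) ^ (1 + δ)) :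
    Tendsto (fun r : ℝ => ∫ θ in (0 : ℝ)..Real.pi, F (x + r * Complex.exp (θ * Complex.I)))
      atTop (nhds 0) := by
  have h := tendsto_halfCircle_integral (l := atTop) x 0 hcont
    (fun z hz => norm_le_of_decay hC hδ hdecay hz) (eventually_ge_atTop 0) fun θ hθ => ?_
  · simpa using h
  · have hdom : Tendsto (fun r : ℝ => C / (1 + (r - |x|)) ^ (1 + δ)) atTop (nhds 0) := by
      refine tendsto_const_nhds.div_atTop ((tendsto_rpow_atTop (by linarith)).comp ?_)
      exact tendsto_atTop_add_const_left _ _ (tendsto_atTop_add_const_right _ _ tendsto_id)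
    refine squeeze_zero_norm' ?_ hdom
    filter_upwards [eventually_ge_atTop |x|] with r hr
    have hr0 : 0 ≤ r := (abs_nonneg x).trans hr
    refine (hdecay _ (im_ofReal_add_mul_exp_nonneg x hr0 hθ)).trans ?_
    have hn : r - |x| ≤ ‖(x : ℂ) + r * Complex.exp (θ * Complex.I)‖ := by
      have := norm_sub_norm_le ((r : ℂ) * Complex.exp (θ * Complex.I)) (-(x : ℂ))
      rw [sub_neg_eq_add, norm_mul, Complex.norm_exp_ofReal_mul_I, norm_neg, Complex.norm_real,
        Complex.norm_real, Real.norm_eq_abs, Real.norm_eq_abs, abs_of_nonneg hr0, mul_one,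
        add_comm] at this
      exact this
    have h1 : 0 < 1 + (r - |x|) := by linarith
    gcongr

/-- Cauchy's theorem on an upper half-annulus, in logarithmic coordinates. -/
lemma halfAnnulus_integral_eq (x a b : ℝ)
    (hcont : ContinuousOn F {z : ℂ | 0 ≤ z.im})
    (hdiff : ∀ z : ℂ, 0 < z.im → DifferentiableAt ℂ F z) :
    (∫ t in a..b, F ((x + Real.exp t : ℝ) : ℂ)) - (∫ t in a..b, F ((x - Real.exp t : ℝ) : ℂ)) =
      Complex.I * (∫ θ in (0 : ℝ)..Real.pi, F (x + Real.exp a * Complex.exp (θ * Complex.I))) -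
      Complex.I * ∫ θ in (0 : ℝ)..Real.pi, F (x + Real.exp b * Complex.exp (θ * Complex.I)) := by
  have key := Complex.integral_boundary_rect_eq_zero_of_continuousOn_of_differentiableOn
    (fun w => F (x + Complex.exp w)) (a : ℂ) (b + Real.pi * Complex.I) ?_ ?_
  · have e1 : ∀ t : ℝ, Complex.exp (t + Real.pi * Complex.I) = -Complex.exp t := fun t => by
      rw [Complex.exp_add, Complex.exp_pi_mul_I]; ring
    simp [e1, Complex.exp_add] at key
    push_cast
    simp only [sub_eq_add_neg] at key ⊢
    linear_combination key
  · refine hcont.comp (by fun_prop) fun w hw => ?_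
    have hw2 : w.im ∈ Set.Icc 0 Real.pi := by
      simpa [Set.uIcc_of_le Real.pi_pos.le] using hw.2
    simp only [Set.mem_ofPred_eq, Complex.add_im, Complex.ofReal_im, zero_add, Complex.exp_im]
    exact mul_nonneg (Real.exp_pos _).le (Real.sin_nonneg_of_mem_Icc hw2)
  · intro w hw
    have hw2 : w.im ∈ Set.Ioo 0 Real.pi := by
      simpa [Real.pi_pos.le] using hw.2
    refine DifferentiableAt.differentiableWithinAt ?_
    refine DifferentiableAt.comp w (hdiff _ ?_) (by fun_prop)
    simp only [Complex.add_im, Complex.ofReal_im, zero_add, Complex.exp_im]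
    exact mul_pos (Real.exp_pos _) (Real.sin_pos_of_mem_Ioo hw2)

lemma continuous_comp_ofReal (hcont : ContinuousOn F {z : ℂ | 0 ≤ z.im}) :
    Continuous fun y : ℝ => F y :=
  hcont.comp_continuous Complex.continuous_ofReal fun y => by simp

lemma measurableSet_lt_abs_sub (x ε : ℝ) : MeasurableSet {y : ℝ | ε < |y - x|} :=
  measurableSet_lt measurable_const (by fun_prop)

/-- The truncated Cauchy kernel is integrable against the boundary values. -/
lemma integrableOn_div_sub (x : ℝ) {ε : ℝ} (hε : 0 < ε)
    (hcont : ContinuousOn F {z : ℂ | 0 ≤ z.im}) (hδ : 0 < δ)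
    (hdecay : ∀ z : ℂ, 0 ≤ z.im → ‖F z‖ ≤ C / (1 + ‖z‖) ^ (1 + δ)) :
    IntegrableOn (fun y : ℝ => F y / ((x - y : ℝ) : ℂ)) {y : ℝ | ε < |y - x|} := by
  have hint : Integrable (fun y : ℝ => C / ε * (1 + ‖y‖) ^ (-(1 + δ))) :=
    (integrable_one_add_norm (by simpa using hδ)).const_mul _
  refine hint.integrableOn.mono' ?_ ?_
  · refine Measurable.aestronglyMeasurable ?_
    exact (continuous_comp_ofReal hcont).measurable.div (by fun_prop)
  · refine (ae_restrict_iff' (measurableSet_lt_abs_sub x ε)).2 (.of_forall fun y hy => ?_)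
    have hy' : ε < |x - y| := by rw [abs_sub_comm]; exact hy
    have h := hdecay (y : ℂ) (by simp)
    rw [Complex.norm_real] at h
    rw [norm_div, Complex.norm_real, Real.norm_eq_abs (x - y), Real.rpow_neg (by positivity)]
    calc ‖F y‖ / |x - y| ≤ (C / (1 + ‖y‖) ^ (1 + δ)) / ε :=
          div_le_div₀ ((norm_nonneg _).trans h) h hε hy'.le
      _ = _ := by ring

/-- The truncated Cauchy integral on the line equals an integral over a half-circle. -/
lemma integral_div_sub_eq (x : ℝ) {ε : ℝ} (hε : 0 < ε)
    (hcont : ContinuousOn F {z : ℂ | 0 ≤ z.im})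
    (hdiff : ∀ z : ℂ, 0 < z.im → DifferentiableAt ℂ F z) (hC : 0 < C) (hδ : 0 < δ)
    (hdecay : ∀ z : ℂ, 0 ≤ z.im → ‖F z‖ ≤ C / (1 + ‖z‖) ^ (1 + δ)) :
    ∫ y in {y : ℝ | ε < |y - x|}, F y / ((x - y : ℝ) : ℂ) =
      -Complex.I * ∫ θ in (0 : ℝ)..Real.pi, F (x + ε * Complex.exp (θ * Complex.I)) := by
  obtain ⟨a, rfl⟩ : ∃ a, Real.exp a = ε := ⟨Real.log ε, Real.exp_log hε⟩
  have hF := continuous_comp_ofReal hcont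
  set h : ℝ → ℂ := fun y => F y / ((x - y : ℝ) : ℂ) with hh
  have hS : {y : ℝ | Real.exp a < |y - x|} =
      Set.Iio (x - Real.exp a) ∪ Set.Ioi (x + Real.exp a) := by
    ext y
    simp only [Set.mem_ofPred_eq, Set.mem_union, Set.mem_Iio, Set.mem_Ioi, lt_abs]
    constructor
    · rintro (h | h)
      · right; linarith
      · left; linarith
    · rintro (h | h)
      · right; linarith
      · left; linarith
  have hint := integrableOn_div_sub x hε hcont hδ hdecay
  rw [hS, integrableOn_union] at hint
  have hcontAt : ContinuousOn h {x}ᶜ := by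
    refine hF.continuousOn.div (by fun_prop) fun y hy => ?_
    rw [Complex.ofReal_ne_zero, sub_ne_zero]
    exact fun e => hy e.symm
  have hright : ∀ b, ∫ y in (x + Real.exp a)..(x + Real.exp b), h y =
      -∫ t in a..b, F ((x + Real.exp t : ℝ) : ℂ) := fun b => by
    rw [← intervalIntegral.integral_deriv_smul_comp'' (f := fun t => x + Real.exp t)
      (f' := Real.exp) (g := h) (by fun_prop)
      (fun t _ => ((Real.hasDerivAt_exp t).const_add x).hasDerivWithinAt) (by fun_prop)
      (hcontAt.mono ?_), ← intervalIntegral.integral_neg]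
    · refine intervalIntegral.integral_congr fun t _ => ?_
      have : (Real.exp t : ℂ) ≠ 0 := Complex.ofReal_ne_zero.2 (Real.exp_ne_zero t)
      simp only [hh, Function.comp, Complex.real_smul]
      rw [show x - (x + Real.exp t) = -Real.exp t by ring, Complex.ofReal_neg]
      field_simp
    · rintro _ ⟨t, -, rfl⟩
      simp [Real.exp_ne_zero]
  have hleft : ∀ b, ∫ y in (x - Real.exp a)..(x - Real.exp b), h y =
      -∫ t in a..b, F ((x - Real.exp t : ℝ) : ℂ) := fun b => by
    rw [← intervalIntegral.integral_deriv_smul_comp'' (f := fun t => x - Real.exp t)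
      (f' := fun t => -Real.exp t) (g := h) (by fun_prop)
      (fun t _ => ((Real.hasDerivAt_exp t).const_sub x).hasDerivWithinAt) (by fun_prop)
      (hcontAt.mono ?_), ← intervalIntegral.integral_neg]
    · refine intervalIntegral.integral_congr fun t _ => ?_
      have : (Real.exp t : ℂ) ≠ 0 := Complex.ofReal_ne_zero.2 (Real.exp_ne_zero t)
      simp only [hh, Function.comp, Complex.real_smul]
      rw [show x - (x - Real.exp t) = Real.exp t by ring, Complex.ofReal_neg]
      field_simp
    · rintro _ ⟨t, -, rfl⟩
      simp [Real.exp_ne_zero]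
  have limR : Tendsto (fun b => ∫ y in (x + Real.exp a)..(x + Real.exp b), h y) atTop
      (nhds (∫ y in Set.Ioi (x + Real.exp a), h y)) :=
    intervalIntegral_tendsto_integral_Ioi _ hint.2
      (tendsto_atTop_add_const_left _ _ Real.tendsto_exp_atTop)
  have limL : Tendsto (fun b => ∫ y in (x - Real.exp b)..(x - Real.exp a), h y) atTop
      (nhds (∫ y in Set.Iic (x - Real.exp a), h y)) :=
    intervalIntegral_tendsto_integral_Iic _ ((integrableOn_Iic_iff_integrableOn_Iio (by simp)).2 hint.1)
      (tendsto_atBot_add_const_left _ _ (tendsto_neg_atTop_atBot.comp Real.tendsto_exp_atTop))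
  have hsum := limL.add limR
  have hJ := (tendsto_halfCircle_integral_atTop x hcont hC hδ hdecay).comp Real.tendsto_exp_atTop
  have hlim := (hJ.const_mul Complex.I).sub_const (Complex.I *
    ∫ θ in (0 : ℝ)..Real.pi, F (x + Real.exp a * Complex.exp (θ * Complex.I)))
  rw [hS, setIntegral_union ?_ measurableSet_Ioi hint.1 hint.2, ← integral_Iic_eq_integral_Iio]
  · refine (tendsto_nhds_unique hsum (hlim.congr fun b => ?_)).trans (by ring)
    rw [intervalIntegral.integral_symm (x - Real.exp a), hleft, hright]
    simp only [Function.comp]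
    linear_combination halfAnnulus_integral_eq x a b hcont hdiff
  · refine Set.disjoint_left.2 fun y hy hy' => ?_
    simp only [Set.mem_Iio, Set.mem_Ioi] at hy hy'
    linarith

end HalfPlane

/-- Hilbert transform relation for boundary values of a holomorphic function:
if F is continuous on the closed upper half-plane, holomorphic on the open
upper half-plane, and |F(z)| ≤ C/(1+|z|)^{1+δ} there, then for every x ∈ ℝ the
principal value integral exists and
lim_{ε→0+} ∫_{|y−x|>ε} Re F(y)/(x − y) dy = π · Im F(x). -/
theorem hilbert_transform_boundary (F : ℂ → ℂ)
    (hcont : ContinuousOn F {z : ℂ | 0 ≤ z.im})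
    (hdiff : ∀ z : ℂ, 0 < z.im → DifferentiableAt ℂ F z)
    (C δ : ℝ) (hC : 0 < C) (hδ : 0 < δ)
    (hdecay : ∀ z : ℂ, 0 ≤ z.im → ‖F z‖ ≤ C / (1 + ‖z‖) ^ (1 + δ)) :
    ∀ x : ℝ,
      (∀ ε : ℝ, 0 < ε →
        IntegrableOn (fun y : ℝ => (F y).re / (x - y)) {y : ℝ | ε < |y - x|}) ∧
      Tendsto (fun ε : ℝ => ∫ y in {y : ℝ | ε < |y - x|}, (F y).re / (x - y))
        (nhdsWithin 0 (Set.Ioi 0)) (nhds (Real.pi * (F x).im)) := by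
  intro x
  have hre : ∀ y : ℝ, (F y).re / (x - y) = (F y / ((x - y : ℝ) : ℂ)).re := fun y =>
    (Complex.div_ofReal_re _ _).symm
  simp only [hre]
  refine ⟨fun ε hε => (integrableOn_div_sub x hε hcont hδ hdecay).re, ?_⟩
  have hlim := ((tendsto_halfCircle_integral_zero x hcont
    fun z hz => norm_le_of_decay hC hδ hdecay hz).const_mul (-Complex.I))
  have hlim' := (Complex.continuous_re.tendsto _).comp hlim
  have hval : (-Complex.I * (Real.pi * F x)).re = Real.pi * (F x).im := by simp
  rw [hval] at hlim'
  refine hlim'.congr' ?_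
  filter_upwards [self_mem_nhdsWithin] with ε hε
  rw [Function.comp, ← integral_div_sub_eq x hε hcont hdiff hC hδ hdecay]
  exact (integral_re (integrableOn_div_sub x hε hcont hδ hdecay)).symm
end

section
/- Let c₁, c₂ be positive reals and s ∈ ℂ with Re s > 2. For w ∈ ℂ with Re w > 0 define I(w) = ∫₀^∞ t^{s−1} e^{−wt} / ((1 − e^{−c₁ t})(1 − e^{−c₂ t})) dt. Then this integral converges absolutely for every such w, and I(w) − I(w + c₁) − I(w + c₂) + I(w + c₁ + c₂) = Γ(s) · w^{−s}, where Γ is the Gamma function and w^{−s} is the principal branch. -/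
open MeasureTheory

/-- The Barnes integral I(w) = ∫₀^∞ t^{s−1} e^{−wt} / ((1−e^{−c₁t})(1−e^{−c₂t})) dt. -/
noncomputable def barnesI (c₁ c₂ : ℝ) (s w : ℂ) : ℂ :=
  ∫ t in Set.Ioi (0:ℝ),
    (t : ℂ) ^ (s - 1) * Complex.exp (-w * t) /
      ((1 - Complex.exp (-(c₁ : ℂ) * t)) * (1 - Complex.exp (-(c₂ : ℂ) * t)))

lemma Real.inv_one_sub_exp_neg_le {x : ℝ} (hx : 0 < x) : (1 - Real.exp (-x))⁻¹ ≤ 1 + x⁻¹ := by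
  have h := Real.add_one_le_exp x
  have hlt : Real.exp (-x) < 1 := Real.exp_lt_one_iff.2 (by linarith)
  have hmul : Real.exp (-x) * Real.exp x = 1 := by rw [← Real.exp_add]; simp
  have key : (x + 1) * Real.exp (-x) ≤ 1 := by
    nlinarith [Real.exp_pos (-x)]
  rw [inv_le_iff_one_le_mul₀ (by linarith)]
  have : (1 + x⁻¹) * (1 - Real.exp (-x)) = (x + 1 - (x + 1) * Real.exp (-x)) / x := by
    field_simp
  rw [this, le_div_iff₀ hx]
  linarith

lemma one_sub_cexp_neg_mul_eq_ofReal (c t : ℝ) :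
    1 - Complex.exp (-(c : ℂ) * t) = ((1 - Real.exp (-(c * t)) : ℝ) : ℂ) := by
  push_cast
  ring_nf

lemma one_sub_cexp_neg_mul_ne_zero {c t : ℝ} (hc : 0 < c) (ht : 0 < t) :
    1 - Complex.exp (-(c : ℂ) * t) ≠ 0 := by
  rw [one_sub_cexp_neg_mul_eq_ofReal, Complex.ofReal_ne_zero]
  have : Real.exp (-(c * t)) < 1 := Real.exp_lt_one_iff.2 (by nlinarith [mul_pos hc ht])
  linarith

lemma norm_inv_one_sub_cexp_neg_mul_le {c t : ℝ} (hc : 0 < c) (ht : 0 < t) :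
    ‖(1 - Complex.exp (-(c : ℂ) * t))⁻¹‖ ≤ 1 + (c * t)⁻¹ := by
  have hct := mul_pos hc ht
  have : Real.exp (-(c * t)) < 1 := Real.exp_lt_one_iff.2 (by linarith)
  rw [one_sub_cexp_neg_mul_eq_ofReal, norm_inv, Complex.norm_of_nonneg (by linarith)]
  exact Real.inv_one_sub_exp_neg_le hct

lemma norm_cpow_mul_cexp_neg_mul {s w : ℂ} {t : ℝ} (ht : 0 < t) :
    ‖(t : ℂ) ^ (s - 1) * Complex.exp (-w * t)‖ = t ^ (s.re - 1) * Real.exp (-w.re * t) := by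
  rw [norm_mul, Complex.norm_cpow_eq_rpow_re_of_pos ht, Complex.norm_exp]
  simp

lemma integrableOn_rpow_mul_exp_neg_mul {p b : ℝ} (hp : -1 < p) (hb : 0 < b) :
    IntegrableOn (fun t : ℝ => t ^ p * Real.exp (-b * t)) (Set.Ioi 0) := by
  simpa using integrableOn_rpow_mul_exp_neg_mul_rpow hp one_pos hb

lemma hasDerivAt_integral_cpow_mul_cexp_neg_mul {s w : ℂ} (hs : 0 < s.re) (hw : 0 < w.re) :
    HasDerivAt (fun z : ℂ => ∫ t in Set.Ioi (0:ℝ), (t : ℂ) ^ (s - 1) * Complex.exp (-z * t))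
      (∫ t in Set.Ioi (0:ℝ), (t : ℂ) ^ (s - 1) * (Complex.exp (-w * t) * (-t))) w := by
  have hU : {z : ℂ | w.re / 2 < z.re} ∈ nhds w :=
    (isOpen_lt continuous_const Complex.continuous_re).mem_nhds (by
      simp only [Set.mem_ofPred_eq]; linarith)
  refine (hasDerivAt_integral_of_dominated_loc_of_deriv_le
    (F := fun (z : ℂ) (t : ℝ) => (t : ℂ) ^ (s - 1) * Complex.exp (-z * t))
    (F' := fun (z : ℂ) (t : ℝ) => (t : ℂ) ^ (s - 1) * (Complex.exp (-z * t) * (-t)))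
    (bound := fun t : ℝ => t ^ s.re * Real.exp (-(w.re / 2) * t))
    hU (.of_forall fun z => ?_) ?_ ?_ ?_ ?_ ?_).2
  · exact Measurable.aestronglyMeasurable (by fun_prop)
  · refine (integrableOn_rpow_mul_exp_neg_mul (p := s.re - 1) (by linarith) hw).mono'
      (Measurable.aestronglyMeasurable (by fun_prop)) ?_
    filter_upwards [ae_restrict_mem measurableSet_Ioi] with t ht
    exact (norm_cpow_mul_cexp_neg_mul ht).le
  · exact Measurable.aestronglyMeasurable (by fun_prop)
  · filter_upwards [ae_restrict_mem measurableSet_Ioi] with t ht z hz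
    have ht : 0 < t := ht
    have hz : w.re / 2 < z.re := hz
    rw [← mul_assoc, norm_mul, norm_cpow_mul_cexp_neg_mul ht, norm_neg,
      Complex.norm_of_nonneg ht.le, mul_right_comm, ← Real.rpow_add_one ht.ne', sub_add_cancel]
    gcongr
  · exact integrableOn_rpow_mul_exp_neg_mul (by linarith) (by linarith)
  · refine .of_forall fun t z _ => ?_
    have h : HasDerivAt (fun z : ℂ => -z * t) (-t : ℂ) z := by
      simpa using (hasDerivAt_id z).neg.mul_const (t : ℂ)
    exact h.cexp.const_mul _

/-- Extension of `Complex.integral_cpow_mul_exp_neg_mul_Ioi` to complex rates. -/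
lemma Complex.integral_cpow_mul_exp_neg_mul_Ioi_of_re_pos {s w : ℂ} (hs : 0 < s.re)
    (hw : 0 < w.re) :
    ∫ t in Set.Ioi (0:ℝ), (t : ℂ) ^ (s - 1) * Complex.exp (-w * t)
      = Complex.Gamma s * w ^ (-s) := by
  have hU : IsOpen {z : ℂ | 0 < z.re} := isOpen_lt continuous_const Complex.continuous_re
  have hF : AnalyticOnNhd ℂ
      (fun z : ℂ => ∫ t in Set.Ioi (0:ℝ), (t : ℂ) ^ (s - 1) * Complex.exp (-z * t))
      {z : ℂ | 0 < z.re} :=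
    DifferentiableOn.analyticOnNhd (fun z hz =>
      (hasDerivAt_integral_cpow_mul_cexp_neg_mul hs hz).differentiableAt.differentiableWithinAt) hU
  have hG : AnalyticOnNhd ℂ (fun z : ℂ => Complex.Gamma s * z ^ (-s)) {z : ℂ | 0 < z.re} :=
    DifferentiableOn.analyticOnNhd (fun z hz =>
      ((differentiableAt_id.cpow_const (Or.inl hz)).const_mul _).differentiableWithinAt) hU
  refine hF.eqOn_of_preconnected_of_frequently_eq hG
    (convex_halfSpace_re_gt 0).isPreconnected (z₀ := ((1 : ℝ) : ℂ)) (by simp) ?_ hw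
  have htends : Filter.Tendsto (fun r : ℝ => (r : ℂ)) (nhdsWithin 1 {1}ᶜ)
      (nhdsWithin ((1 : ℝ) : ℂ) {((1 : ℝ) : ℂ)}ᶜ) :=
    Complex.continuous_ofReal.continuousWithinAt.tendsto_nhdsWithin fun r hr => by
      simpa using hr
  refine htends.frequently (Filter.Eventually.frequently ?_)
  filter_upwards [nhdsWithin_le_nhds (lt_mem_nhds one_pos)] with r hr
  have harg : (r : ℂ).arg ≠ Real.pi := by
    rw [Complex.arg_ofReal_of_nonneg hr.le]
    exact Real.pi_pos.ne
  simp_rw [neg_mul]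
  rw [Complex.integral_cpow_mul_exp_neg_mul_Ioi hs hr, one_div, Complex.inv_cpow _ _ harg,
    ← Complex.cpow_neg, mul_comm]

lemma integrableOn_barnes_integrand {c₁ c₂ : ℝ} (h₁ : 0 < c₁) (h₂ : 0 < c₂)
    {s : ℂ} (hs : 2 < s.re) {w : ℂ} (hw : 0 < w.re) :
    IntegrableOn (fun t : ℝ =>
      (t : ℂ) ^ (s - 1) * Complex.exp (-w * t) /
        ((1 - Complex.exp (-(c₁ : ℂ) * t)) * (1 - Complex.exp (-(c₂ : ℂ) * t))))
      (Set.Ioi (0:ℝ)) := by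
  have hpow (p : ℝ) (hp : -1 < p) := integrableOn_rpow_mul_exp_neg_mul hp hw
  have hdom := ((hpow (s.re - 1) (by linarith)).add
    ((hpow (s.re - 2) (by linarith)).const_mul (c₁⁻¹ + c₂⁻¹))).add
    ((hpow (s.re - 3) (by linarith)).const_mul (c₁⁻¹ * c₂⁻¹))
  refine Integrable.mono' hdom ?_ ?_
  · exact Measurable.aestronglyMeasurable (by fun_prop)
  · filter_upwards [ae_restrict_mem measurableSet_Ioi] with t ht
    have ht : 0 < t := ht
    have e2 : t ^ (s.re - 2) = t ^ (s.re - 1) * t⁻¹ := by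
      rw [← Real.rpow_neg_one t, ← Real.rpow_add ht]; ring_nf
    have e3 : t ^ (s.re - 3) = t ^ (s.re - 1) * t⁻¹ * t⁻¹ := by
      rw [← Real.rpow_neg_one t, ← Real.rpow_add ht, ← Real.rpow_add ht]; ring_nf
    rw [div_eq_mul_inv, mul_inv, norm_mul, norm_mul _⁻¹, norm_cpow_mul_cexp_neg_mul ht]
    calc _ ≤ t ^ (s.re - 1) * Real.exp (-w.re * t) *
          ((1 + (c₁ * t)⁻¹) * (1 + (c₂ * t)⁻¹)) := by
          gcongr
          · exact norm_inv_one_sub_cexp_neg_mul_le h₁ ht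
          · exact norm_inv_one_sub_cexp_neg_mul_le h₂ ht
      _ = _ := by
          simp only [Pi.add_apply, e2, e3, mul_inv]
          ring

/-- For c₁, c₂ > 0, Re s > 2 and Re w > 0, the Barnes integral converges
absolutely, and I(w) − I(w+c₁) − I(w+c₂) + I(w+c₁+c₂) = Γ(s)·w^{−s}
(principal branch). -/
theorem barnes_difference_equation (c₁ c₂ : ℝ) (h₁ : 0 < c₁) (h₂ : 0 < c₂)
    (s : ℂ) (hs : 2 < s.re) (w : ℂ) (hw : 0 < w.re) :
    IntegrableOn (fun t : ℝ =>
      (t : ℂ) ^ (s - 1) * Complex.exp (-w * t) /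
        ((1 - Complex.exp (-(c₁ : ℂ) * t)) * (1 - Complex.exp (-(c₂ : ℂ) * t))))
      (Set.Ioi (0:ℝ)) ∧
    barnesI c₁ c₂ s w - barnesI c₁ c₂ s (w + c₁) - barnesI c₁ c₂ s (w + c₂)
        + barnesI c₁ c₂ s (w + c₁ + c₂)
      = Complex.Gamma s * w ^ (-s) := by
  have hI {z : ℂ} (hz : 0 < z.re) := integrableOn_barnes_integrand h₁ h₂ hs hz
  refine ⟨hI hw, ?_⟩
  have hw₁ : 0 < (w + c₁).re := by simpa using add_pos hw h₁
  have hw₂ : 0 < (w + c₂).re := by simpa using add_pos hw h₂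
  have hw₁₂ : 0 < (w + c₁ + c₂).re := by simpa using add_pos (add_pos hw h₁) h₂
  have hGamma : ∫ t in Set.Ioi (0:ℝ), (t : ℂ) ^ (s - 1) * Complex.exp (-w * t)
      = Complex.Gamma s * w ^ (-s) :=
    Complex.integral_cpow_mul_exp_neg_mul_Ioi_of_re_pos (by linarith) hw
  unfold barnesI
  rw [← integral_sub' (hI hw) (hI hw₁), ← integral_sub' ((hI hw).sub (hI hw₁)) (hI hw₂),
    ← integral_add' (((hI hw).sub (hI hw₁)).sub (hI hw₂)) (hI hw₁₂), ← hGamma]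
  refine setIntegral_congr_fun measurableSet_Ioi fun t ht => ?_
  have n₁ := one_sub_cexp_neg_mul_ne_zero h₁ ht
  have n₂ := one_sub_cexp_neg_mul_ne_zero h₂ ht
  have x₁ : Complex.exp (-(w + c₁) * t)
      = Complex.exp (-w * t) * Complex.exp (-(c₁ : ℂ) * t) := by
    rw [← Complex.exp_add]; ring_nf
  have x₂ : Complex.exp (-(w + c₂) * t)
      = Complex.exp (-w * t) * Complex.exp (-(c₂ : ℂ) * t) := by
    rw [← Complex.exp_add]; ring_nf
  have x₁₂ : Complex.exp (-(w + c₁ + c₂) * t)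
      = Complex.exp (-w * t) * Complex.exp (-(c₁ : ℂ) * t) * Complex.exp (-(c₂ : ℂ) * t) := by
    rw [← Complex.exp_add, ← Complex.exp_add]; ring_nf
  simp only [x₁, x₂, x₁₂, Pi.add_apply, Pi.sub_apply]
  rw [← sub_div, ← sub_div, ← add_div, div_eq_iff (mul_ne_zero n₁ n₂)]
  ring
end
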